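/- arXiv:2109.06357 — 3 statements merged into one kernel-verified Lean document; each statement's English description precedes it below -/
import Mathlib

section
/- Fix α₄, α₆, α₈ ∈ ℂ and η ∈ ℂ. Let F = ℂ⟨u₀,…,u₅⟩ be the free associative unital ℂ-algebra on six generators (write u = u₀) and let 𝒟 be the unique ℂ-derivation of F with 𝒟(u_k) = u_{k+1} for 0 ≤ k ≤ 4 and 𝒟(u₅) = 𝒢₈ := 7(u₄u + uu₄) + 14(u₃u₁ + u₁u₃) + 21u₂² − 21(u₂u² + u²u₂) − 28(u₁²u + uu₁²) − 28uu₂u − 14u₁uu₁ + 35u⁴ − 16α₄(u₂ − 3u²) − 64α₆u + 128α₈. Let J(η) ⊆ F be the two-sided ideal generated by: the commutators u_iu_j − u_ju_i for all pairs 0 ≤ i < j ≤ 5 with i + j < 5 or i + j = 6; together with u₀u₅ − u₅u₀ − η, u₄u₁ − u₁u₄ − η, u₂u₃ − u₃u₂ − η, u₂u₅ − u₅u₂ − 14η·u₀, u₄u₃ − u₃u₄ − 14η·u₀, u₅u₃ − u₃u₅ − 14η·u₁, and u₄u₅ − u₅u₄ − 2η·(63u₀² + 14u₂ − 8α₄).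 Then J(η) is 𝒟-invariant: 𝒟(J(η)) ⊆ J(η). -/
/-- An exchange relation `a * b = b * a + c` in the middle of a right-associated product. -/
theorem mul_mul_of_mul_eq_mul_add {A : Type*} [Ring A] {a b c : A} (h : a * b = b * a + c) (x : A) :
    a * (b * x) = b * (a * x) + c * x := by
  rw [← mul_assoc, h, add_mul, mul_assoc]

/-- Commuting factors in the middle of a right-associated product. -/
theorem mul_mul_of_mul_eq_mul {A : Type*} [Ring A] {a b : A} (h : a * b = b * a) (x : A) :
    a * (b * x) = b * (a * x) := by
  rw [← mul_assoc, h, mul_assoc]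

/-- Multiplication by a numeral is scalar multiplication by the same complex numeral. -/
theorem ofNat_mul_eq_smul {A : Type*} [Ring A] [Algebra ℂ A] (n : ℕ) [n.AtLeastTwo] (x : A) :
    (ofNat(n) : A) * x = (ofNat(n) : ℂ) • x := by
  rw [Algebra.smul_def, map_ofNat]

/-- The right-hand side `𝒢₈` of the `N = 3` Novikov equation, evaluated in a `ℂ`-algebra. -/
def novikovG8 {A : Type*} [Ring A] [Algebra ℂ A] (α₄ α₆ α₈ : ℂ) (v : Fin 6 → A) : A :=
  (7 : ℂ) • (v 4 * v 0 + v 0 * v 4) + (14 : ℂ) • (v 3 * v 1 + v 1 * v 3)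
    + (21 : ℂ) • (v 2 * v 2) - (21 : ℂ) • (v 2 * (v 0 * v 0) + v 0 * (v 0 * v 2))
    - (28 : ℂ) • (v 1 * (v 1 * v 0) + v 0 * (v 1 * v 1)) - (28 : ℂ) • (v 0 * (v 2 * v 0))
    - (14 : ℂ) • (v 1 * (v 0 * v 1)) + (35 : ℂ) • (v 0 * (v 0 * (v 0 * v 0)))
    - (16 * α₄) • (v 2 - (3 : ℂ) • (v 0 * v 0)) - (64 * α₆) • v 0 + (128 * α₈) • (1 : A)

/-- The quantum commutation relations of the `N = 3` Novikov equation, written as rules which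
exchange each pair of generators into increasing order. -/
structure NovikovRelations {A : Type*} [Ring A] [Algebra ℂ A] (α₄ η : ℂ) (v : Fin 6 → A) :
    Prop where
  h10 : v 1 * v 0 = v 0 * v 1
  h20 : v 2 * v 0 = v 0 * v 2
  h30 : v 3 * v 0 = v 0 * v 3
  h40 : v 4 * v 0 = v 0 * v 4
  h21 : v 2 * v 1 = v 1 * v 2
  h31 : v 3 * v 1 = v 1 * v 3
  h51 : v 5 * v 1 = v 1 * v 5
  h42 : v 4 * v 2 = v 2 * v 4
  h50 : v 5 * v 0 = v 0 * v 5 + (-η) • (1 : A)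
  h41 : v 4 * v 1 = v 1 * v 4 + η • (1 : A)
  h32 : v 3 * v 2 = v 2 * v 3 + (-η) • (1 : A)
  h52 : v 5 * v 2 = v 2 * v 5 + (-(14 * η)) • v 0
  h43 : v 4 * v 3 = v 3 * v 4 + (14 * η) • v 0
  h53 : v 5 * v 3 = v 3 * v 5 + (14 * η) • v 1
  h54 : v 5 * v 4 = v 4 * v 5 + (-(2 * η)) • ((63 : ℂ) • (v 0 * v 0) + (14 : ℂ) • v 2
    - (8 * α₄) • (1 : A))

namespace NovikovRelations

variable {A : Type*} [Ring A] [Algebra ℂ A] {α₄ η : ℂ} {v : Fin 6 → A}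

/-- The commutators of the generators with `𝒢₈` are consistent with differentiating the
relations for the pairs `(v i, v 5)`. -/
theorem commutator_novikovG8 (h : NovikovRelations α₄ η v) (α₆ α₈ : ℂ) :
    v 0 * novikovG8 α₄ α₆ α₈ v - novikovG8 α₄ α₆ α₈ v * v 0 = v 5 * v 1 - v 1 * v 5 ∧
    v 1 * novikovG8 α₄ α₆ α₈ v - novikovG8 α₄ α₆ α₈ v * v 1 = v 5 * v 2 - v 2 * v 5 ∧
    v 2 * novikovG8 α₄ α₆ α₈ v - novikovG8 α₄ α₆ α₈ v * v 2 =
      v 5 * v 3 - v 3 * v 5 + (14 * η) • v 1 ∧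
    v 3 * novikovG8 α₄ α₆ α₈ v - novikovG8 α₄ α₆ α₈ v * v 3 =
      v 5 * v 4 - v 4 * v 5 - (14 * η) • v 2 ∧
    v 4 * novikovG8 α₄ α₆ α₈ v - novikovG8 α₄ α₆ α₈ v * v 4 =
      (2 * η) • ((63 : ℂ) • (v 1 * v 0 + v 0 * v 1) + (14 : ℂ) • v 3) := by
  refine ⟨?_, ?_, ?_, ?_, ?_⟩ <;>
  simp only [novikovG8, mul_add, add_mul, mul_sub, sub_mul, smul_mul_assoc, mul_smul_comm,
    mul_assoc, mul_one, one_mul, smul_add, smul_sub, h.h10, h.h20, h.h30, h.h40, h.h21, h.h31, h.h51,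
    h.h42, h.h41, h.h32, h.h52, h.h43, h.h53, mul_mul_of_mul_eq_mul h.h10,
    mul_mul_of_mul_eq_mul h.h20, mul_mul_of_mul_eq_mul h.h30, mul_mul_of_mul_eq_mul h.h40,
    mul_mul_of_mul_eq_mul h.h21, mul_mul_of_mul_eq_mul h.h31, mul_mul_of_mul_eq_mul h.h42,
    mul_mul_of_mul_eq_mul_add h.h41, mul_mul_of_mul_eq_mul_add h.h32, h.h54] <;>
  module

end NovikovRelations

/-- The two-sided ideal `J(η)` of `F = ℂ⟨u₀,…,u₅⟩` generated by the quantum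
commutation relations of the `N = 3` Novikov equation is invariant under the
derivation `𝒟` with `𝒟(u_k) = u_{k+1}` (`0 ≤ k ≤ 4`) and `𝒟(u₅) = 𝒢₈`. -/
theorem nc_N3_quantisation_ideal_invariant (α₄ α₆ α₈ η : ℂ)
    (𝒟 : FreeAlgebra ℂ (Fin 6) →ₗ[ℂ] FreeAlgebra ℂ (Fin 6))
    (hleib : ∀ x y : FreeAlgebra ℂ (Fin 6), 𝒟 (x * y) = 𝒟 x * y + x * 𝒟 y)
    (u : Fin 6 → FreeAlgebra ℂ (Fin 6)) (hu : ∀ k, u k = FreeAlgebra.ι ℂ k)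
    (hk : ∀ k : Fin 5, 𝒟 (u k.castSucc) = u k.succ)
    (h5 : 𝒟 (u 5) = 7 * (u 4 * u 0 + u 0 * u 4) + 14 * (u 3 * u 1 + u 1 * u 3)
        + 21 * (u 2) ^ 2 - 21 * (u 2 * (u 0) ^ 2 + (u 0) ^ 2 * u 2)
        - 28 * ((u 1) ^ 2 * u 0 + u 0 * (u 1) ^ 2) - 28 * (u 0 * u 2 * u 0)
        - 14 * (u 1 * u 0 * u 1) + 35 * (u 0) ^ 4
        - (16 * α₄) • (u 2 - 3 * (u 0) ^ 2) - (64 * α₆) • u 0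
        + algebraMap ℂ (FreeAlgebra ℂ (Fin 6)) (128 * α₈))
    (G : Set (FreeAlgebra ℂ (Fin 6)))
    (hG : G = {x : FreeAlgebra ℂ (Fin 6) | ∃ i j : Fin 6, i < j ∧
          ((i : ℕ) + (j : ℕ) < 5 ∨ (i : ℕ) + (j : ℕ) = 6) ∧
          x = u i * u j - u j * u i} ∪
        {u 0 * u 5 - u 5 * u 0 - algebraMap ℂ (FreeAlgebra ℂ (Fin 6)) η,
         u 4 * u 1 - u 1 * u 4 - algebraMap ℂ (FreeAlgebra ℂ (Fin 6)) η,
         u 2 * u 3 - u 3 * u 2 - algebraMap ℂ (FreeAlgebra ℂ (Fin 6)) η,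
         u 2 * u 5 - u 5 * u 2 - (14 * η) • u 0,
         u 4 * u 3 - u 3 * u 4 - (14 * η) • u 0,
         u 5 * u 3 - u 3 * u 5 - (14 * η) • u 1,
         u 4 * u 5 - u 5 * u 4 - (2 * η) • (63 * (u 0) ^ 2 + 14 * u 2
            - algebraMap ℂ (FreeAlgebra ℂ (Fin 6)) (8 * α₄))})
    -- `J` is the two-sided ideal generated by `G`
    (J : Submodule ℂ (FreeAlgebra ℂ (Fin 6)))
    (hJ : J = Submodule.span ℂ
        {x : FreeAlgebra ℂ (Fin 6) | ∃ (a b g : FreeAlgebra ℂ (Fin 6)),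
          g ∈ G ∧ x = a * g * b}) :
    ∀ x ∈ J, 𝒟 x ∈ J := by
  have h01 : 𝒟 (u 0) = u 1 := hk 0
  have h12 : 𝒟 (u 1) = u 2 := hk 1
  have h23 : 𝒟 (u 2) = u 3 := hk 2
  have h34 : 𝒟 (u 3) = u 4 := hk 3
  have h45 : 𝒟 (u 4) = u 5 := hk 4
  have h1 : 𝒟 1 = 0 := by simpa using hleib 1 1
  let I : Ideal (FreeAlgebra ℂ (Fin 6)) :=
    { J.toAddSubmonoid with
      smul_mem' := fun c x (hx : x ∈ J) ↦ show c * x ∈ J by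
        rw [hJ] at hx ⊢
        induction hx using Submodule.span_induction with
        | mem x hx =>
          obtain ⟨a, b, g, hg, rfl⟩ := hx
          exact Submodule.subset_span ⟨c * a, b, g, hg, by simp only [mul_assoc]⟩
        | zero => simp
        | add x y _ _ hx hy => rw [mul_add]; exact add_mem hx hy
        | smul r x _ hx => rw [mul_smul_comm]; exact Submodule.smul_mem _ r hx }
  have hI : I.IsTwoSided := ⟨fun {x} c (hx : x ∈ J) ↦ show x * c ∈ J by
    rw [hJ] at hx ⊢
    induction hx using Submodule.span_induction with
    | mem x hx =>
      obtain ⟨a, b, g, hg, rfl⟩ := hx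
      exact Submodule.subset_span ⟨a, b * c, g, hg, by simp only [mul_assoc]⟩
    | zero => simp
    | add x y _ _ hx hy => rw [add_mul]; exact add_mem hx hy
    | smul r x _ hx => rw [smul_mul_assoc]; exact Submodule.smul_mem _ r hx⟩
  have hGJ : ∀ g ∈ G, g ∈ J := fun g hg ↦ by
    rw [hJ]
    exact Submodule.subset_span ⟨1, 1, g, hg, by simp⟩
  let φ := Ideal.Quotient.mkₐ ℂ I
  have hφ : ∀ x, φ x = 0 ↔ x ∈ J := fun x ↦ Ideal.Quotient.eq_zero_iff_mem (I := I)
  have hφG : ∀ g ∈ G, φ g = 0 := fun g hg ↦ (hφ g).2 (hGJ g hg)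
  have hcomm : ∀ i j : Fin 6, i < j → ((i : ℕ) + (j : ℕ) < 5 ∨ (i : ℕ) + (j : ℕ) = 6) →
      φ (u j) * φ (u i) = φ (u i) * φ (u j) := fun i j hij h ↦ by
    have := hφG (u i * u j - u j * u i) (hG ▸ Or.inl ⟨i, j, hij, h, rfl⟩)
    rw [map_sub, map_mul, map_mul, sub_eq_zero] at this
    exact this.symm
  have hrel : NovikovRelations α₄ η (fun i ↦ φ (u i)) := by
    have hpair := fun g hg ↦ hφG g (hG ▸ Or.inr hg)
    simp only [Set.mem_insert_iff, Set.mem_singleton_iff, forall_eq_or_imp, forall_eq,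
      Algebra.algebraMap_eq_smul_one, map_sub, map_mul, map_smul, map_add, map_one, pow_two,
      ofNat_mul_eq_smul] at hpair
    obtain ⟨h50, h41, h32, h52, h43, h53, h54⟩ := hpair
    exact
      { h10 := hcomm 0 1 (by decide) (by decide)
        h20 := hcomm 0 2 (by decide) (by decide)
        h30 := hcomm 0 3 (by decide) (by decide)
        h40 := hcomm 0 4 (by decide) (by decide)
        h21 := hcomm 1 2 (by decide) (by decide)
        h31 := hcomm 1 3 (by decide) (by decide)
        h51 := hcomm 1 5 (by decide) (by decide)
        h42 := hcomm 2 4 (by decide) (by decide)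
        h50 := by linear_combination (norm := module) -h50
        h41 := by linear_combination (norm := module) h41
        h32 := by linear_combination (norm := module) -h32
        h52 := by linear_combination (norm := module) -h52
        h43 := by linear_combination (norm := module) h43
        h53 := by linear_combination (norm := module) h53
        h54 := by linear_combination (norm := module) -h54 }
  have hD5 : φ (𝒟 (u 5)) = novikovG8 α₄ α₆ α₈ (fun i ↦ φ (u i)) := by
    rw [h5]
    simp only [novikovG8, ofNat_mul_eq_smul, Algebra.algebraMap_eq_smul_one, map_sub, map_add,
      map_mul, map_smul, map_one, pow_succ, pow_zero, one_mul, mul_assoc]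
  obtain ⟨hc0, hc1, hc2, hc3, hc4⟩ := hrel.commutator_novikovG8 α₆ α₈
  rw [← hD5, sub_eq_iff_eq_add'] at hc0 hc1 hc2 hc3 hc4
  have hDG : ∀ g ∈ G, φ (𝒟 g) = 0 := by
    rw [hG]
    rintro g (⟨i, j, hij, h, rfl⟩ | hg)
    · fin_cases i <;> fin_cases j <;> first
        | exact absurd hij (by decide)
        | exact absurd h (by decide)
        | simp only [Fin.zero_eta, Fin.mk_one, Fin.reduceFinMk, map_sub, map_add, map_mul, hleib,
            h01, h12, h23, h34, h45, hc1, hrel.h20, hrel.h30, hrel.h40, hrel.h21,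
            hrel.h31, hrel.h50, hrel.h41, hrel.h32, hrel.h52, hrel.h43]
          module
    · revert g
      simp only [Set.mem_insert_iff, Set.mem_singleton_iff, forall_eq_or_imp, forall_eq,
        Algebra.algebraMap_eq_smul_one, map_sub, map_mul, map_smul, map_add, pow_two,
        ofNat_mul_eq_smul, hleib, h01, h12, h23, h34, h45, h1, map_zero, hc0, hc2, hc3, hc4]
      simp only [hrel.h51, hrel.h42, hrel.h53, hrel.h54]
      refine ⟨?_, ?_, ?_, ?_, ?_, ?_, ?_⟩ <;> module
  intro x hx
  rw [hJ] at hx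
  induction hx using Submodule.span_induction with
  | mem x hx =>
    obtain ⟨a, b, g, hg, rfl⟩ := hx
    rw [← hφ]
    simp [hleib, hφG g hg, hDG g hg]
  | zero => simp
  | add x y _ _ hx hy => rw [map_add]; exact add_mem hx hy
  | smul r x _ hx => rw [map_smul]; exact Submodule.smul_mem _ r hx
end

section
/- Fix α₄, c ∈ ℂ. Let F = ℂ⟨u,u₁⟩ be the free associative unital ℂ-algebra on two generators and let A = F/⟨uu₁ − u₁u − c⟩ be the quotient by the two-sided ideal generated by uu₁ − u₁u − c. Let h ∈ A be the image of (1/16)·(u₁² − 2u³ − 16α₄u). Then in A: [u, h] = (c/8)·u₁ and [u₁, h] = (c/8)·(3u² + 8α₄). In particular, with c = 8iℏ, the quantum N=1 Novikov equation takes the Heisenberg form iℏ·∂_{t₁}(u) = [u, h] = iℏ·u₁ and iℏ·∂_{t₁}(u₁) = [u₁, h] = iℏ·(3u² + 8α₄). -/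
/-- The commutators of `x` and `y` with `(1/16)(y² − 2x³ − 16αx)` when `xy − yx = c`. -/
theorem heisenberg_commutators {A : Type*} [Ring A] [Algebra ℂ A] (α c : ℂ) (x y : A)
    (hxy : x * y = y * x + algebraMap ℂ A c) :
    x * (((1 : ℂ) / 16) • (y ^ 2 - 2 * x ^ 3 - (16 * α) • x)) -
        (((1 : ℂ) / 16) • (y ^ 2 - 2 * x ^ 3 - (16 * α) • x)) * x = (c / 8) • y ∧
    y * (((1 : ℂ) / 16) • (y ^ 2 - 2 * x ^ 3 - (16 * α) • x)) -
        (((1 : ℂ) / 16) • (y ^ 2 - 2 * x ^ 3 - (16 * α) • x)) * y =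
      (c / 8) • (3 * x ^ 2 + algebraMap ℂ A (8 * α)) := by
  rw [Algebra.algebraMap_eq_smul_one] at hxy
  have hxy_sq : x * y ^ 2 = y ^ 2 * x + (2 * c) • y := by
    rw [pow_two, ← mul_assoc, hxy, add_mul, mul_assoc, hxy, mul_add, mul_assoc]
    simp only [mul_smul_comm, smul_mul_assoc, mul_one, one_mul]
    module
  have hx_sq_y : x ^ 2 * y = y * x ^ 2 + (2 * c) • x := by
    rw [pow_two, mul_assoc, hxy, mul_add, ← mul_assoc, hxy, add_mul, mul_assoc]
    simp only [mul_smul_comm, smul_mul_assoc, mul_one, one_mul]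
    module
  have hx_cube_y : x ^ 3 * y = y * x ^ 3 + (3 * c) • x ^ 2 := by
    rw [pow_succ' x 2, mul_assoc, hx_sq_y, mul_add, ← mul_assoc, hxy, add_mul, mul_assoc]
    simp only [mul_smul_comm, smul_mul_assoc, one_mul, ← pow_two]
    module
  have hcomm : x * x ^ 3 = x ^ 3 * x := (pow_mul_comm' x 3).symm
  have hcomm' : y * y ^ 2 = y ^ 2 * y := (pow_mul_comm' y 2).symm
  simp only [Algebra.algebraMap_eq_smul_one, two_mul,
    show (3 : A) * x ^ 2 = (3 : ℂ) • x ^ 2 by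
      rw [Algebra.smul_def, map_ofNat]]
  simp only [mul_smul_comm, smul_mul_assoc, mul_sub, sub_mul, mul_add, add_mul, hxy, hxy_sq,
    hx_cube_y, hcomm, hcomm']
  constructor <;> module


/-- In the quotient algebra `A = ℂ⟨u,u₁⟩/⟨uu₁ − u₁u − c⟩`, with
`h = (1/16)(u₁² − 2u³ − 16α₄u)`, the quantum `N = 1` Novikov equation takes the
Heisenberg form: `[u,h] = (c/8)·u₁` and `[u₁,h] = (c/8)·(3u² + 8α₄)`. -/
theorem quantum_N1_heisenberg_form (α₄ c : ℂ)
    (u u₁ : FreeAlgebra ℂ (Fin 2))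
    (hu : u = FreeAlgebra.ι ℂ 0) (hu₁ : u₁ = FreeAlgebra.ι ℂ 1)
    (r : FreeAlgebra ℂ (Fin 2) → FreeAlgebra ℂ (Fin 2) → Prop)
    (hr : r = fun x y =>
      x = u * u₁ ∧ y = u₁ * u + algebraMap ℂ (FreeAlgebra ℂ (Fin 2)) c)
    (φ : FreeAlgebra ℂ (Fin 2) →ₐ[ℂ] RingQuot r)
    (hφ : φ = RingQuot.mkAlgHom ℂ r)
    (h : RingQuot r)
    (hh : h = φ (((1 : ℂ) / 16) • (u₁ ^ 2 - 2 * u ^ 3 - (16 * α₄) • u))) :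
    φ u * h - h * φ u = (c / 8) • φ u₁ ∧
    φ u₁ * h - h * φ u₁ =
      (c / 8) • (3 * (φ u) ^ 2 + algebraMap ℂ (RingQuot r) (8 * α₄)) := by
  subst hh hφ
  have hrel : RingQuot.mkAlgHom ℂ r u * RingQuot.mkAlgHom ℂ r u₁ =
      RingQuot.mkAlgHom ℂ r u₁ * RingQuot.mkAlgHom ℂ r u + algebraMap ℂ (RingQuot r) c := by
    have hmk : RingQuot.mkAlgHom ℂ r (u * u₁) =
        RingQuot.mkAlgHom ℂ r (u₁ * u + algebraMap ℂ (FreeAlgebra ℂ (Fin 2)) c) :=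
      RingQuot.mkAlgHom_rel ℂ (by rw [hr]; exact ⟨rfl, rfl⟩)
    rwa [map_add, map_mul, map_mul, AlgHom.commutes] at hmk
  simp only [map_smul, map_sub, map_mul, map_pow, map_ofNat (RingQuot.mkAlgHom ℂ r)]
  simpa only [map_mul] using heisenberg_commutators α₄ c _ _ hrel
end

section
/- Fix α₄, c ∈ ℂ. Let F = ℂ⟨u,u₁⟩ be the free associative unital ℂ-algebra on two generators and let A = F/⟨uu₁ − u₁u − c⟩ be the quotient by the two-sided ideal generated by uu₁ − u₁u − c. Then in A the identities u₁u² + u²u₁ − 2uu₁u = 0 and uu₁² + u₁²u − 2u₁uu₁ = 0 hold. Consequently, the fifth KdV symmetry of the N=1 Novikov equation, given on F by 16·S(u) = u₁u² + u²u₁ − 2uu₁u − 16α₄u₁ and 16·S(u₁) = −(uu₁² + u₁²u) + 2u₁uu₁ − 48α₄u² − 128α₄², reduces on A to S(u) = −α₄·u₁ and S(u₁) = −α₄·(3u² + 8α₄). -/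
/-- If the commutator of `a` and `b` commutes with `a`, then `[a, [a, b]] = 0` in expanded form. -/
theorem double_commutator_left_eq_zero {R : Type*} [Ring R] {a b k : R}
    (h : a * b = b * a + k) (hk : Commute k a) :
    b * a ^ 2 + a ^ 2 * b - 2 * (a * b * a) = 0 := by
  have hk' : k = a * b - b * a := by rw [h]; abel
  calc b * a ^ 2 + a ^ 2 * b - 2 * (a * b * a)
      = a * (a * b - b * a) - (a * b - b * a) * a := by noncomm_ring
    _ = 0 := by rw [← hk', hk.eq, sub_self]

/-- If the commutator of `a` and `b` commutes with `b`, then `[[a, b], b] = 0` in expanded form. -/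
theorem double_commutator_right_eq_zero {R : Type*} [Ring R] {a b k : R}
    (h : a * b = b * a + k) (hk : Commute k b) :
    a * b ^ 2 + b ^ 2 * a - 2 * (b * a * b) = 0 := by
  have hk' : k = a * b - b * a := by rw [h]; abel
  calc a * b ^ 2 + b ^ 2 * a - 2 * (b * a * b)
      = (a * b - b * a) * b - b * (a * b - b * a) := by noncomm_ring
    _ = 0 := by rw [← hk', hk.eq, sub_self]


/-- In the quotient algebra `A = ℂ⟨u,u₁⟩/⟨uu₁ − u₁u − c⟩` the identities
`u₁u² + u²u₁ − 2uu₁u = 0` and `uu₁² + u₁²u − 2u₁uu₁ = 0` hold; consequently the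
fifth KdV symmetry `S` of the `N = 1` Novikov equation reduces on `A` to
`S(u) = −α₄u₁`, `S(u₁) = −α₄(3u² + 8α₄)`. -/
theorem quantum_N1_fifth_symmetry_reduction (α₄ c : ℂ)
    (u u₁ : FreeAlgebra ℂ (Fin 2))
    (hu : u = FreeAlgebra.ι ℂ 0) (hu₁ : u₁ = FreeAlgebra.ι ℂ 1)
    (r : FreeAlgebra ℂ (Fin 2) → FreeAlgebra ℂ (Fin 2) → Prop)
    (hr : r = fun x y =>
      x = u * u₁ ∧ y = u₁ * u + algebraMap ℂ (FreeAlgebra ℂ (Fin 2)) c)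
    (φ : FreeAlgebra ℂ (Fin 2) →ₐ[ℂ] RingQuot r)
    (hφ : φ = RingQuot.mkAlgHom ℂ r) :
    φ (u₁ * u ^ 2 + u ^ 2 * u₁ - 2 * (u * u₁ * u)) = 0 ∧
    φ (u * u₁ ^ 2 + u₁ ^ 2 * u - 2 * (u₁ * u * u₁)) = 0 ∧
    (∀ S : FreeAlgebra ℂ (Fin 2) →ₗ[ℂ] FreeAlgebra ℂ (Fin 2),
      (∀ x y : FreeAlgebra ℂ (Fin 2), S (x * y) = S x * y + x * S y) →
      (16 : ℂ) • S u = u₁ * u ^ 2 + u ^ 2 * u₁ - 2 * (u * u₁ * u) - (16 * α₄) • u₁ →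
      (16 : ℂ) • S u₁ = -(u * u₁ ^ 2 + u₁ ^ 2 * u) + 2 * (u₁ * u * u₁)
          - (48 * α₄) • u ^ 2
          - algebraMap ℂ (FreeAlgebra ℂ (Fin 2)) (128 * α₄ ^ 2) →
      φ (S u) = (-α₄) • φ u₁ ∧
      φ (S u₁) = (-α₄) • (3 * (φ u) ^ 2 + algebraMap ℂ (RingQuot r) (8 * α₄))) := by
  have hcomm : φ u * φ u₁ = φ u₁ * φ u + algebraMap ℂ (RingQuot r) c := by
    have hrel : r (u * u₁) (u₁ * u + algebraMap ℂ (FreeAlgebra ℂ (Fin 2)) c) := by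
      rw [hr]; exact ⟨rfl, rfl⟩
    have h := RingQuot.mkAlgHom_rel ℂ hrel
    rw [← hφ] at h
    simpa only [map_add, map_mul, AlgHom.commutes] using h
  have h₁ : φ (u₁ * u ^ 2 + u ^ 2 * u₁ - 2 * (u * u₁ * u)) = 0 := by
    simpa only [map_add, map_sub, map_mul, map_pow, map_ofNat] using
      double_commutator_left_eq_zero hcomm (Algebra.commutes c (φ u))
  have h₂ : φ (u * u₁ ^ 2 + u₁ ^ 2 * u - 2 * (u₁ * u * u₁)) = 0 := by
    simpa only [map_add, map_sub, map_mul, map_pow, map_ofNat] using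
      double_commutator_right_eq_zero hcomm (Algebra.commutes c (φ u₁))
  refine ⟨h₁, h₂, fun S _ hSu hSu₁ => ⟨?_, ?_⟩⟩
  · have h : (16 : ℂ) • φ (S u) = -((16 * α₄) • φ u₁) := by
      rw [← map_smul, hSu, map_sub, h₁, map_smul, zero_sub]
    apply smul_right_injective _ (show (16 : ℂ) ≠ 0 by norm_num)
    simp only [h]
    module
  · have h : (16 : ℂ) • φ (S u₁) =
        -((48 * α₄) • φ u ^ 2) - algebraMap ℂ (RingQuot r) (128 * α₄ ^ 2) := by
      have hneg : -(u * u₁ ^ 2 + u₁ ^ 2 * u) + 2 * (u₁ * u * u₁) =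
          -(u * u₁ ^ 2 + u₁ ^ 2 * u - 2 * (u₁ * u * u₁)) := by abel
      rw [← map_smul, hSu₁, hneg, map_sub, map_sub, map_neg, h₂, map_smul, map_pow,
        AlgHom.commutes, neg_zero, zero_sub]
    have h3 : (3 : RingQuot r) * φ u ^ 2 = (3 : ℂ) • φ u ^ 2 := by
      rw [Algebra.smul_def, map_ofNat]
    apply smul_right_injective _ (show (16 : ℂ) ≠ 0 by norm_num)
    simp only [h, h3, Algebra.algebraMap_eq_smul_one]
    module
end
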